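/- arXiv:1209.2820 — 3 statements merged into one kernel-verified Lean document; each statement's English description precedes it below -/
import Mathlib

section
/- (Law of Monotonic Channel Capacity, Theorem 1) Let K be a Markov kernel from a standard Borel input space 𝒳 to a standard Borel output space 𝒴, and let b : 𝒳 → [0, ∞) be an unbounded cost function. Then the exact-cost capacity–cost function C(β) is a nondecreasing function of β: for all β ≥ β′ ≥ 0, C(β) ≥ C(β′). -/
open MeasureTheory ProbabilityTheory
open scoped ENNReal NNReal

/-- Kullback–Leibler divergence between two measures, valued in `ℝ≥0∞`. -/
noncomputable def klDiv {Ω : Type*} [MeasurableSpace Ω] (μ ν : Measure Ω) : ℝ≥0∞ :=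
  open scoped Classical in
  if μ ≪ ν ∧ Integrable (llr μ ν) μ then ENNReal.ofReal (∫ x, llr μ ν x ∂μ) else ⊤

/-- Mutual information of an input distribution `μ` and a channel (Markov kernel) `K`:
the KL divergence between the joint law `μ ⊗ₘ K` and the product of its two marginals. -/
noncomputable def mutualInfo {𝒳 𝒴 : Type*} [MeasurableSpace 𝒳] [MeasurableSpace 𝒴]
    (μ : Measure 𝒳) (K : Kernel 𝒳 𝒴) : ℝ≥0∞ :=
  klDiv (μ ⊗ₘ K) (((μ ⊗ₘ K).fst).prod ((μ ⊗ₘ K).snd))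

/-- Exact-cost capacity–cost function: the supremum of the mutual information over all
input probability measures with cost exactly `β`. -/
noncomputable def capacity {𝒳 𝒴 : Type*} [MeasurableSpace 𝒳] [MeasurableSpace 𝒴]
    (K : Kernel 𝒳 𝒴) (b : 𝒳 → ℝ≥0) (β : ℝ≥0) : ℝ≥0∞ :=
  ⨆ μ : {μ : Measure 𝒳 // IsProbabilityMeasure μ ∧ ∫⁻ x, (b x : ℝ≥0∞) ∂μ = (β : ℝ≥0∞)},
    mutualInfo μ.1 K

namespace InformationTheory

variable {𝓧 𝓨 : Type*} [MeasurableSpace 𝓧] [MeasurableSpace 𝓨]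

/-- The divergence between composition-products with a common first marginal is an integral of
the kernel Radon-Nikodym derivative, which does not depend on that marginal. -/
lemma klDiv_compProd_right_eq_lintegral_klFun [StandardBorelSpace 𝓨]
    (μ : Measure 𝓧) [IsFiniteMeasure μ] (κ η : Kernel 𝓧 𝓨) [IsMarkovKernel κ] [IsMarkovKernel η]
    (h : ∀ᵐ a ∂μ, κ a ≪ η a) :
    klDiv (μ ⊗ₘ κ) (μ ⊗ₘ η) =
      ∫⁻ p, ENNReal.ofReal (klFun (κ.rnDeriv η p.1 p.2).toReal) ∂(μ ⊗ₘ η) := by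
  have hmeas : Measurable (Function.uncurry (κ.rnDeriv η)) := Kernel.measurable_rnDeriv κ η
  have hfin : IsFiniteKernel (η.withDensity (κ.rnDeriv η)) := by
    refine ⟨1, by simp, fun a ↦ ?_⟩
    exact (Kernel.withDensity_rnDeriv_le κ η a Set.univ).trans prob_le_one
  have hdens : μ ⊗ₘ κ = (μ ⊗ₘ η).withDensity (Function.uncurry (κ.rnDeriv η)) := by
    calc μ ⊗ₘ κ = μ ⊗ₘ (η.withDensity (κ.rnDeriv η)) :=
          Measure.compProd_congr (h.mono fun a ha ↦ (Kernel.withDensity_rnDeriv_eq ha).symm)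
      _ = _ := Measure.compProd_withDensity hmeas
  have hrn : (μ ⊗ₘ κ).rnDeriv (μ ⊗ₘ η) =ᵐ[μ ⊗ₘ η] Function.uncurry (κ.rnDeriv η) := by
    rw [hdens]
    exact Measure.rnDeriv_withDensity _ hmeas
  rw [klDiv_eq_lintegral_klFun_of_ac (Measure.absolutelyContinuous_compProd_right_iff.mpr h)]
  refine lintegral_congr_ae (hrn.mono fun p hp ↦ ?_)
  simp only [hp, Function.uncurry_def]

/-- For fixed kernels, the conditional divergence is superhomogeneous in the input measure. -/
lemma mul_klDiv_compProd_right_le [StandardBorelSpace 𝓨]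
    {μ ρ : Measure 𝓧} [IsFiniteMeasure μ] [IsFiniteMeasure ρ] (κ η : Kernel 𝓧 𝓨)
    [IsMarkovKernel κ] [IsMarkovKernel η] {c : ℝ≥0} (hc : c ≠ 0) (hle : c • μ ≤ ρ) :
    c * klDiv (μ ⊗ₘ κ) (μ ⊗ₘ η) ≤ klDiv (ρ ⊗ₘ κ) (ρ ⊗ₘ η) := by
  by_cases hρ : ∀ᵐ a ∂ρ, κ a ≪ η a
  swap
  · rw [klDiv_of_not_ac (Measure.absolutelyContinuous_compProd_right_iff.not.mpr hρ)]
    exact le_top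
  have hcμ : (c : ℝ≥0∞) • μ ≤ ρ := hle
  have hac : μ ≪ ρ := (Measure.absolutelyContinuous_smul (by simpa using hc)).trans
    hcμ.absolutelyContinuous
  rw [klDiv_compProd_right_eq_lintegral_klFun μ κ η (hac.ae_le hρ),
    klDiv_compProd_right_eq_lintegral_klFun ρ κ η hρ, ← smul_eq_mul,
    ← lintegral_smul_measure, ← Measure.compProd_smul_left]
  refine lintegral_mono' ?_ le_rfl
  refine Measure.le_intro fun s hs _ ↦ ?_
  rw [Measure.compProd_apply hs, Measure.compProd_apply hs]
  exact lintegral_mono' hcμ le_rfl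

lemma klDiv_map_swap (μ ν : Measure (𝓧 × 𝓨)) [IsFiniteMeasure μ] [IsFiniteMeasure ν] :
    klDiv (μ.map Prod.swap) (ν.map Prod.swap) = klDiv μ ν := by
  refine le_antisymm (klDiv_map_le μ ν measurable_swap) ?_
  have h := klDiv_map_le (μ.map Prod.swap) (ν.map Prod.swap) (measurable_swap (α := 𝓨) (β := 𝓧))
  simpa [Measure.map_map measurable_swap measurable_swap] using h

/-- Among product measures with first marginal `μ`, the divergence from `μ ⊗ₘ κ` is smallest at
the product of its marginals. -/
lemma klDiv_compProd_prod_comp_le [StandardBorelSpace 𝓧] [Nonempty 𝓧]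
    (μ : Measure 𝓧) [IsProbabilityMeasure μ] (κ : Kernel 𝓧 𝓨) [IsMarkovKernel κ]
    (ν : Measure 𝓨) [IsProbabilityMeasure ν] :
    klDiv (μ ⊗ₘ κ) (μ.prod (κ ∘ₘ μ)) ≤ klDiv (μ ⊗ₘ κ) (μ.prod ν) := by
  rw [← klDiv_map_swap _ (μ.prod (κ ∘ₘ μ)), ← klDiv_map_swap _ (μ.prod ν), Measure.prod_swap,
    Measure.prod_swap, ← compProd_posterior_eq_map_swap, ← Measure.compProd_const,
    ← Measure.compProd_const, klDiv_compProd_eq_add _ ν]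
  exact le_add_self

end InformationTheory

lemma klDiv_eq_klDiv {Ω : Type*} [MeasurableSpace Ω] (μ ν : Measure Ω)
    [IsProbabilityMeasure μ] [IsProbabilityMeasure ν] :
    klDiv μ ν = InformationTheory.klDiv μ ν := by
  simp [klDiv, InformationTheory.klDiv_def]

lemma mutualInfo_eq {𝒳 𝒴 : Type*} [MeasurableSpace 𝒳] [MeasurableSpace 𝒴]
    (μ : Measure 𝒳) [IsProbabilityMeasure μ] (K : Kernel 𝒳 𝒴) [IsMarkovKernel K] :
    mutualInfo μ K = InformationTheory.klDiv (μ ⊗ₘ K) (μ.prod (K ∘ₘ μ)) := by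
  rw [mutualInfo, klDiv_eq_klDiv, Measure.fst_compProd, Measure.snd_compProd]

/-- If the input distribution `ρ` has a component `μ` of weight `c`, its mutual information is at
least `c` times that of `μ`. -/
lemma mul_mutualInfo_le {𝒳 𝒴 : Type*} [MeasurableSpace 𝒳] [StandardBorelSpace 𝒳] [Nonempty 𝒳]
    [MeasurableSpace 𝒴] [StandardBorelSpace 𝒴] {μ ρ : Measure 𝒳} [IsProbabilityMeasure μ]
    [IsProbabilityMeasure ρ] (K : Kernel 𝒳 𝒴) [IsMarkovKernel K] {c : ℝ≥0} (hle : c • μ ≤ ρ) :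
    c * mutualInfo μ K ≤ mutualInfo ρ K := by
  rcases eq_or_ne c 0 with rfl | hc
  · simp
  rw [mutualInfo_eq, mutualInfo_eq]
  calc c * InformationTheory.klDiv (μ ⊗ₘ K) (μ.prod (K ∘ₘ μ))
      ≤ c * InformationTheory.klDiv (μ ⊗ₘ K) (μ.prod (K ∘ₘ ρ)) := by
        gcongr
        exact InformationTheory.klDiv_compProd_prod_comp_le μ K (K ∘ₘ ρ)
    _ ≤ InformationTheory.klDiv (ρ ⊗ₘ K) (ρ.prod (K ∘ₘ ρ)) := by
        simp_rw [← Measure.compProd_const]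
        exact InformationTheory.mul_klDiv_compProd_right_le K _ hc hle

/-- **Law of Monotonic Channel Capacity** (Theorem 1): for a point-to-point channel given by
a Markov kernel between standard Borel spaces and an unbounded cost function `b`,
the exact-cost capacity–cost function is nondecreasing. -/
theorem law_of_monotonic_channel_capacity
    {𝒳 𝒴 : Type*} [MeasurableSpace 𝒳] [StandardBorelSpace 𝒳]
    [MeasurableSpace 𝒴] [StandardBorelSpace 𝒴]
    (K : Kernel 𝒳 𝒴) [IsMarkovKernel K]
    (b : 𝒳 → ℝ≥0) (hb : Measurable b)
    (hb_unbounded : ∀ b₀ : ℝ≥0, ∃ x : 𝒳, b x = b₀)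
    (β β' : ℝ≥0) (h : β' ≤ β) :
    capacity K b β' ≤ capacity K b β := by
  have : Nonempty 𝒳 := ⟨(hb_unbounded 0).choose⟩
  refine iSup_le fun ⟨μ, hμ, hcost⟩ ↦ ?_
  suffices hmul : ∀ c : ℝ≥0, c < 1 → c * mutualInfo μ K ≤ capacity K b β by
    rw [← one_mul (mutualInfo μ K)]
    refine ENNReal.mul_le_of_forall_lt fun a ha I hI ↦ ?_
    lift a to ℝ≥0 using ha.ne_top
    exact (mul_le_mul_right hI.le _).trans (hmul a (by exact_mod_cast ha))
  intro c hc
  have hc' : 1 - c ≠ 0 := (tsub_pos_of_lt hc).ne'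
  have hcβ : c * β' ≤ β := (mul_le_of_le_one_left zero_le hc.le).trans h
  obtain ⟨x, hx⟩ := hb_unbounded ((β - c * β') / (1 - c))
  have hsum : c + (1 - c) = 1 := add_tsub_cancel_of_le hc.le
  let ρ : Measure 𝒳 := c • μ + (1 - c) • Measure.dirac x
  have hρ : IsProbabilityMeasure ρ := ⟨by
    simp only [ρ, Measure.add_apply, Measure.smul_apply, measure_univ, ENNReal.smul_def,
      smul_eq_mul, mul_one]
    exact_mod_cast hsum⟩
  have hρcost : ∫⁻ y, (b y : ℝ≥0∞) ∂ρ = β := by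
    rw [lintegral_add_measure, lintegral_smul_measure, lintegral_smul_measure, hcost,
      lintegral_dirac' x hb.coe_nnreal_ennreal, hx]
    simp only [ENNReal.smul_def, smul_eq_mul, ← ENNReal.coe_mul, ← ENNReal.coe_add]
    rw [mul_div_cancel₀ _ hc', add_tsub_cancel_of_le hcβ]
  exact (mul_mutualInfo_le K (Measure.le_add_right le_rfl)).trans
    (le_iSup (fun ν : {ν : Measure 𝒳 // IsProbabilityMeasure ν ∧
      ∫⁻ x, (b x : ℝ≥0∞) ∂ν = (β : ℝ≥0∞)} ↦ mutualInfo ν.1 K) ⟨ρ, hρ, hρcost⟩)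
end

section
/- (Corollary 1) Let K be a Markov kernel from a standard Borel input space 𝒳 to a standard Borel output space 𝒴, and let b : 𝒳 → [0, ∞) be an unbounded cost function. Then the two definitions of the capacity–cost function are equivalent: C̃(β) = C(β) for all β ≥ 0. -/
open MeasureTheory ProbabilityTheory
open scoped ENNReal NNReal

/-- Bounded-cost capacity–cost function: the supremum of the mutual information over all
input probability measures with cost at most `β` (the supremum over an empty set is `0`). -/
noncomputable def capacityLE {𝒳 𝒴 : Type*} [MeasurableSpace 𝒳] [MeasurableSpace 𝒴]
    (K : Kernel 𝒳 𝒴) (b : 𝒳 → ℝ≥0) (β : ℝ≥0) : ℝ≥0∞ :=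
  ⨆ μ : {μ : Measure 𝒳 // IsProbabilityMeasure μ ∧ ∫⁻ x, (b x : ℝ≥0∞) ∂μ ≤ (β : ℝ≥0∞)},
    mutualInfo μ.1 K

namespace ProbabilityTheory

/-- For probability measures, the divergence `klDiv` is the one of Mathlib. -/
lemma klDiv_eq_informationTheory_klDiv {Ω : Type*} [MeasurableSpace Ω] (μ ν : Measure Ω)
    [IsProbabilityMeasure μ] [IsProbabilityMeasure ν] :
    _root_.klDiv μ ν = InformationTheory.klDiv μ ν := by
  rw [InformationTheory.klDiv_def, _root_.klDiv]
  simp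

variable {𝒳 𝒴 : Type*} [MeasurableSpace 𝒳] [MeasurableSpace 𝒴]

lemma mutualInfo_eq_klDiv (μ : Measure 𝒳) [IsProbabilityMeasure μ]
    (K : Kernel 𝒳 𝒴) [IsMarkovKernel K] :
    mutualInfo μ K = InformationTheory.klDiv (μ ⊗ₘ K) (μ ⊗ₘ Kernel.const 𝒳 (K ∘ₘ μ)) := by
  rw [mutualInfo, Measure.fst_compProd, Measure.snd_compProd, klDiv_eq_informationTheory_klDiv,
    Measure.compProd_const]

lemma compProd_eq_withDensity_rnDeriv {μ ν : Measure 𝒳} [IsFiniteMeasure μ] [IsFiniteMeasure ν]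
    (hμν : μ ≪ ν) (κ : Kernel 𝒳 𝒴) [IsFiniteKernel κ] :
    μ ⊗ₘ κ = (ν ⊗ₘ κ).withDensity (fun p ↦ μ.rnDeriv ν p.1) := by
  rw [← withDensity_congr_ae (rnDeriv_measure_compProd_left μ ν κ),
    Measure.withDensity_rnDeriv_eq _ _ (hμν.compProd_left κ)]

lemma compProd_eq_withDensity_rnDeriv_compProd {μ ν : Measure 𝒳}
    [IsFiniteMeasure μ] [IsFiniteMeasure ν] (hμν : μ ≪ ν) {κ η : Kernel 𝒳 𝒴}
    [IsFiniteKernel κ] [IsFiniteKernel η] (hκη : ν ⊗ₘ κ ≪ ν ⊗ₘ η) :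
    μ ⊗ₘ κ = (μ ⊗ₘ η).withDensity ((ν ⊗ₘ κ).rnDeriv (ν ⊗ₘ η)) := by
  rw [compProd_eq_withDensity_rnDeriv hμν κ, compProd_eq_withDensity_rnDeriv hμν η,
    ← withDensity_mul _ (by fun_prop) (by fun_prop), mul_comm,
    withDensity_mul _ (by fun_prop) (by fun_prop), Measure.withDensity_rnDeriv_eq _ _ hκη]

/-- The conditional divergence is monotone in the (unnormalized) conditioning measure. -/
lemma mul_klDiv_compProd_le {μ ν : Measure 𝒳} [IsFiniteMeasure μ] [IsFiniteMeasure ν]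
    {t : ℝ≥0∞} (ht : t ≠ 0) (hμν : t • μ ≤ ν) (κ η : Kernel 𝒳 𝒴)
    [IsFiniteKernel κ] [IsFiniteKernel η] :
    t * InformationTheory.klDiv (μ ⊗ₘ κ) (μ ⊗ₘ η) ≤
      InformationTheory.klDiv (ν ⊗ₘ κ) (ν ⊗ₘ η) := by
  by_cases hκη : ν ⊗ₘ κ ≪ ν ⊗ₘ η
  swap; · simp [hκη]
  have hac : μ ≪ ν :=
    (Measure.absolutelyContinuous_smul ht).trans (Measure.absolutelyContinuous_of_le hμν)
  have hdens := compProd_eq_withDensity_rnDeriv_compProd hac hκη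
  have hac' : μ ⊗ₘ κ ≪ μ ⊗ₘ η := by
    rw [hdens]
    exact withDensity_absolutelyContinuous _ _
  have hrn : (μ ⊗ₘ κ).rnDeriv (μ ⊗ₘ η) =ᵐ[μ ⊗ₘ η] (ν ⊗ₘ κ).rnDeriv (ν ⊗ₘ η) := by
    conv_lhs => rw [hdens]
    exact Measure.rnDeriv_withDensity _ (by fun_prop)
  rw [InformationTheory.klDiv_eq_lintegral_klFun_of_ac hκη,
    InformationTheory.klDiv_eq_lintegral_klFun_of_ac hac']
  have hle : t • (μ ⊗ₘ η) ≤ ν ⊗ₘ η := by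
    rw [← Measure.compProd_smul_left]
    refine Measure.le_iff.2 fun s hs ↦ ?_
    rw [Measure.compProd_apply hs, Measure.compProd_apply hs]
    exact lintegral_mono' hμν le_rfl
  calc t * ∫⁻ p, ENNReal.ofReal (InformationTheory.klFun
        ((μ ⊗ₘ κ).rnDeriv (μ ⊗ₘ η) p).toReal) ∂(μ ⊗ₘ η)
      = t * ∫⁻ p, ENNReal.ofReal (InformationTheory.klFun
        ((ν ⊗ₘ κ).rnDeriv (ν ⊗ₘ η) p).toReal) ∂(μ ⊗ₘ η) := by
        congr 1
        refine lintegral_congr_ae ?_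
        filter_upwards [hrn] with p hp
        rw [hp]
    _ = ∫⁻ p, ENNReal.ofReal (InformationTheory.klFun
        ((ν ⊗ₘ κ).rnDeriv (ν ⊗ₘ η) p).toReal) ∂(t • (μ ⊗ₘ η)) := by
        rw [lintegral_smul_measure, smul_eq_mul]
    _ ≤ _ := lintegral_mono' hle le_rfl

/-- The output marginal minimizes the divergence between the joint law and the products of the
input law with an arbitrary output law. -/
lemma mutualInfo_le_klDiv_const [StandardBorelSpace 𝒳] [Nonempty 𝒳]
    (μ : Measure 𝒳) [IsProbabilityMeasure μ] (K : Kernel 𝒳 𝒴) [IsMarkovKernel K]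
    (ρ : Measure 𝒴) [IsProbabilityMeasure ρ] :
    mutualInfo μ K ≤ InformationTheory.klDiv (μ ⊗ₘ K) (μ ⊗ₘ Kernel.const 𝒳 ρ) := by
  rw [mutualInfo_eq_klDiv, Measure.compProd_const, Measure.compProd_const]
  have hswap : ((K ∘ₘ μ) ⊗ₘ K†μ).map Prod.swap = μ ⊗ₘ K := by
    rw [compProd_posterior_eq_map_swap, Measure.map_map measurable_swap measurable_swap]
    simp
  calc InformationTheory.klDiv (μ ⊗ₘ K) (μ.prod (K ∘ₘ μ))
      = InformationTheory.klDiv (((K ∘ₘ μ) ⊗ₘ K†μ).map Prod.swap)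
          (((K ∘ₘ μ).prod μ).map Prod.swap) := by
        rw [hswap, Measure.prod_swap]
    _ ≤ InformationTheory.klDiv ((K ∘ₘ μ) ⊗ₘ K†μ) ((K ∘ₘ μ).prod μ) :=
        InformationTheory.klDiv_map_le _ _ measurable_swap
    _ ≤ InformationTheory.klDiv ((K ∘ₘ μ) ⊗ₘ K†μ) (ρ.prod μ) := by
        rw [← Measure.compProd_const, ← Measure.compProd_const,
          InformationTheory.klDiv_compProd_eq_add (K ∘ₘ μ) ρ]
        exact le_add_self
    _ = InformationTheory.klDiv ((μ ⊗ₘ K).map Prod.swap) ((μ.prod ρ).map Prod.swap) := by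
        rw [compProd_posterior_eq_map_swap, Measure.prod_swap]
    _ ≤ InformationTheory.klDiv (μ ⊗ₘ K) (μ.prod ρ) :=
        InformationTheory.klDiv_map_le _ _ measurable_swap

/-- If `ν` dominates `t • μ`, then the mutual information of `ν` dominates `t` times that of
`μ`. -/
lemma mul_mutualInfo_le [StandardBorelSpace 𝒳] [Nonempty 𝒳]
    {μ ν : Measure 𝒳} [IsProbabilityMeasure μ] [IsProbabilityMeasure ν]
    {t : ℝ≥0∞} (ht : t ≠ 0) (hμν : t • μ ≤ ν) (K : Kernel 𝒳 𝒴) [IsMarkovKernel K] :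
    t * mutualInfo μ K ≤ mutualInfo ν K := by
  rw [mutualInfo_eq_klDiv ν]
  calc t * mutualInfo μ K
      ≤ t * InformationTheory.klDiv (μ ⊗ₘ K) (μ ⊗ₘ Kernel.const 𝒳 (K ∘ₘ ν)) := by
        gcongr
        exact mutualInfo_le_klDiv_const μ K (K ∘ₘ ν)
    _ ≤ _ := mul_klDiv_compProd_le ht hμν K _

/-- With an unbounded cost, an input law of cost at most `β` can be perturbed by an arbitrarily
small atom into an input law of cost exactly `β`. -/
lemma exists_lintegral_eq_of_smul_le {b : 𝒳 → ℝ≥0} (hb : Measurable b)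
    (hb_unbounded : ∀ b₀ : ℝ≥0, ∃ x : 𝒳, b x = b₀) {β : ℝ≥0}
    (μ : Measure 𝒳) [IsProbabilityMeasure μ] (hμ : ∫⁻ x, (b x : ℝ≥0∞) ∂μ ≤ β)
    {t : ℝ≥0} (ht : t < 1) :
    ∃ ν : Measure 𝒳, IsProbabilityMeasure ν ∧ ∫⁻ x, (b x : ℝ≥0∞) ∂ν = β ∧
      (t : ℝ≥0∞) • μ ≤ ν := by
  lift (∫⁻ x, (b x : ℝ≥0∞) ∂μ) to ℝ≥0 using (hμ.trans_lt ENNReal.coe_lt_top).ne with c hc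
  have hcβ : c ≤ β := by exact_mod_cast hμ
  obtain ⟨d, rfl⟩ := exists_add_of_le hcβ
  obtain ⟨s, hs⟩ := exists_add_of_le ht.le
  have hs0 : s ≠ 0 := by
    rintro rfl
    simp_all
  obtain ⟨x, hx⟩ := hb_unbounded (c + d / s)
  refine ⟨(t : ℝ≥0∞) • μ + (s : ℝ≥0∞) • Measure.dirac x, ⟨?_⟩, ?_,
    Measure.le_add_right le_rfl⟩
  · simp only [Measure.add_apply, Measure.smul_apply, measure_univ, smul_eq_mul, mul_one]
    exact_mod_cast hs.symm
  · rw [lintegral_add_measure, lintegral_smul_measure, lintegral_smul_measure, ← hc,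
      lintegral_dirac' x (by fun_prop), hx, smul_eq_mul, smul_eq_mul]
    norm_cast
    rw [mul_add, mul_div_cancel₀ _ hs0, ← add_assoc, ← add_mul, ← hs, one_mul]

end ProbabilityTheory

/-- Corollary 1: for a point-to-point channel between standard Borel spaces with an unbounded
cost function, the bounded-cost and exact-cost capacity–cost functions coincide:
`C̃(β) = C(β)` for all `β ≥ 0`. -/
theorem capacityLE_eq_capacity
    {𝒳 𝒴 : Type*} [MeasurableSpace 𝒳] [StandardBorelSpace 𝒳]
    [MeasurableSpace 𝒴] [StandardBorelSpace 𝒴]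
    (K : Kernel 𝒳 𝒴) [IsMarkovKernel K]
    (b : 𝒳 → ℝ≥0) (hb : Measurable b)
    (hb_unbounded : ∀ b₀ : ℝ≥0, ∃ x : 𝒳, b x = b₀)
    (β : ℝ≥0) :
    capacityLE K b β = capacity K b β := by
  have : Nonempty 𝒳 := ⟨(hb_unbounded 0).choose⟩
  refine le_antisymm (iSup_le fun ⟨μ, hμ, hμβ⟩ ↦ ?_)
    (iSup_le fun ⟨μ, hμ, hμβ⟩ ↦
      le_iSup_of_le (ι := {μ : Measure 𝒳 // IsProbabilityMeasure μ ∧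
        ∫⁻ x, (b x : ℝ≥0∞) ∂μ ≤ (β : ℝ≥0∞)}) ⟨μ, hμ, hμβ.le⟩ le_rfl)
  refine ENNReal.le_of_forall_nnreal_lt fun r hr ↦ ?_
  have key (t : ℝ≥0) (ht0 : t ≠ 0) (ht : t < 1) :
      (t : ℝ≥0∞) * mutualInfo μ K ≤ capacity K b β := by
    obtain ⟨ν, hν, hνβ, hle⟩ := exists_lintegral_eq_of_smul_le hb hb_unbounded μ hμβ ht
    exact (mul_mutualInfo_le (by exact_mod_cast ht0) hle K).trans
      (le_iSup_of_le (ι := {μ : Measure 𝒳 // IsProbabilityMeasure μ ∧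
        ∫⁻ x, (b x : ℝ≥0∞) ∂μ = (β : ℝ≥0∞)}) ⟨ν, hν, hνβ⟩ le_rfl)
  obtain ⟨q, hrq, hq⟩ := ENNReal.lt_iff_exists_nnreal_btwn.1 hr
  have hrq' : r < q := by exact_mod_cast hrq
  have hq0 : q ≠ 0 := (bot_le.trans_lt hrq').ne'
  rcases eq_or_ne r 0 with rfl | hr0
  · simp
  calc (r : ℝ≥0∞) = ((r / q : ℝ≥0) : ℝ≥0∞) * q := by
        rw [← ENNReal.coe_mul, div_mul_cancel₀ _ hq0]
    _ ≤ ((r / q : ℝ≥0) : ℝ≥0∞) * mutualInfo μ K := by gcongr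
    _ ≤ capacity K b β :=
        key _ (div_ne_zero hr0 hq0) ((div_lt_one (bot_le.trans_lt hrq')).2 hrq')
end

section
/- (Lemma 1) Let X and Y be random variables taking values in standard Borel spaces and let Z be a random variable taking values in a finite (or countable) set, all defined on a common probability space. Then the mutual information and the conditional mutual information satisfy |I(X;Y) − I(X;Y|Z)| ≤ H(Z), where H(Z) is the Shannon entropy of Z. -/
open MeasureTheory ProbabilityTheory
open scoped ENNReal NNReal

/-- Mutual information `I(X;Y)` of two random variables: the KL divergence between the joint
law of `(X, Y)` and the product of the marginal laws. -/
noncomputable def miRV {Ω 𝒳 𝒴 : Type*} [MeasurableSpace Ω] [MeasurableSpace 𝒳]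
    [MeasurableSpace 𝒴] (μ : Measure Ω) (X : Ω → 𝒳) (Y : Ω → 𝒴) : ℝ≥0∞ :=
  klDiv (μ.map (fun ω => (X ω, Y ω))) ((μ.map X).prod (μ.map Y))

/-- Conditional mutual information `I(X;Y|Z)` for a random variable `Z` with countable range:
the average over `z` of the mutual information of `X` and `Y` under the conditional measure
given `Z = z`. -/
noncomputable def condMIRV {Ω 𝒳 𝒴 𝒵 : Type*} [MeasurableSpace Ω] [MeasurableSpace 𝒳]
    [MeasurableSpace 𝒴] [MeasurableSpace 𝒵]
    (μ : Measure Ω) (X : Ω → 𝒳) (Y : Ω → 𝒴) (Z : Ω → 𝒵) : ℝ≥0∞ :=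
  ∑' z : 𝒵, μ (Z ⁻¹' {z}) * miRV (μ[|Z ⁻¹' {z}]) X Y

/-- Shannon entropy `H(Z)` (in nats) of a random variable `Z` with countable range. -/
noncomputable def entropyRV {Ω 𝒵 : Type*} [MeasurableSpace Ω] [MeasurableSpace 𝒵]
    (μ : Measure Ω) (Z : Ω → 𝒵) : ℝ≥0∞ :=
  ∑' z : 𝒵, ENNReal.ofReal (Real.negMulLog ((μ.map Z) {z}).toReal)


section LogLikelihoodRatio

variable {α β : Type*} {mα : MeasurableSpace α} {mβ : MeasurableSpace β}
  {μ ν : Measure α} {c : ℝ≥0∞}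

lemma absolutelyContinuous_of_smul_le (hc : c ≠ 0) (h : c • μ ≤ ν) : μ ≪ ν :=
  (Measure.absolutelyContinuous_smul hc).trans h.absolutelyContinuous

lemma Integrable.of_smul_le (hc : c ≠ 0) (hc' : c ≠ ∞) (h : c • μ ≤ ν) {f : α → ℝ}
    (hf : Integrable f ν) : Integrable f μ :=
  (integrable_smul_measure hc hc').1 (hf.mono_measure h)

lemma toReal_rnDeriv_pos [SigmaFinite μ] [SigmaFinite ν] (h : μ ≪ ν) :
    ∀ᵐ x ∂μ, 0 < (μ.rnDeriv ν x).toReal := by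
  filter_upwards [Measure.rnDeriv_pos h, h.ae_le (Measure.rnDeriv_ne_top μ ν)] with x h1 h2
  exact ENNReal.toReal_pos h1.ne' h2

lemma rnDeriv_le_inv_of_smul_le [SigmaFinite μ] [SigmaFinite ν] (hc : c ≠ 0) (hc' : c ≠ ∞)
    (h : c • μ ≤ ν) : ∀ᵐ x ∂ν, μ.rnDeriv ν x ≤ c⁻¹ := by
  filter_upwards [Measure.rnDeriv_le_one_of_le h, Measure.rnDeriv_smul_left_of_ne_top' μ ν hc']
    with x hx hx'
  rw [hx', Pi.smul_apply, smul_eq_mul, Pi.one_apply] at hx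
  rwa [← one_mul c⁻¹, ← div_eq_mul_inv, ENNReal.le_div_iff_mul_le (.inl hc) (.inl hc'), mul_comm]

lemma llr_le_neg_log_of_smul_le [SigmaFinite μ] [SigmaFinite ν] (hc : c ≠ 0) (hc' : c ≠ ∞)
    (h : c • μ ≤ ν) : ∀ᵐ x ∂μ, llr μ ν x ≤ -Real.log c.toReal := by
  have hμν := absolutelyContinuous_of_smul_le hc h
  filter_upwards [hμν.ae_le (rnDeriv_le_inv_of_smul_le hc hc' h),
    toReal_rnDeriv_pos hμν] with x hx hx'
  rw [llr_def, ← Real.log_inv, ← ENNReal.toReal_inv]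
  exact Real.log_le_log hx' (ENNReal.toReal_mono (ENNReal.inv_ne_top.2 hc) hx)

/-- A measure dominated by a multiple of another one has an integrable log-likelihood ratio. -/
lemma integrable_llr_of_smul_le [IsFiniteMeasure μ] [IsFiniteMeasure ν] (hc : c ≠ 0)
    (hc' : c ≠ ∞) (h : c • μ ≤ ν) : Integrable (llr μ ν) μ := by
  rw [← InformationTheory.integrable_klFun_rnDeriv_iff (absolutelyContinuous_of_smul_le hc h)]
  obtain ⟨C, hC⟩ := (isCompact_Icc (a := (0 : ℝ)) (b := (c⁻¹).toReal)).exists_bound_of_continuousOn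
    InformationTheory.continuous_klFun.continuousOn
  refine Integrable.of_bound (InformationTheory.measurable_klFun.comp
    (Measure.measurable_rnDeriv μ ν).ennreal_toReal).aestronglyMeasurable C ?_
  filter_upwards [rnDeriv_le_inv_of_smul_le hc hc' h] with x hx
  exact hC _ ⟨ENNReal.toReal_nonneg, ENNReal.toReal_mono (ENNReal.inv_ne_top.2 hc) hx⟩

lemma integral_llr_nonneg [IsProbabilityMeasure μ] [IsProbabilityMeasure ν] (h : μ ≪ ν)
    (h_int : Integrable (llr μ ν) μ) : 0 ≤ ∫ x, llr μ ν x ∂μ := by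
  simpa using InformationTheory.integral_llr_add_sub_measure_univ_nonneg h h_int

lemma llr_chain {κ : Measure α} [SigmaFinite μ] [SigmaFinite ν] [SigmaFinite κ]
    (hμν : μ ≪ ν) (hνκ : ν ≪ κ) : ∀ᵐ x ∂μ, llr μ κ x = llr μ ν x + llr ν κ x := by
  filter_upwards [(hμν.trans hνκ).ae_le (Measure.rnDeriv_mul_rnDeriv (κ := κ) hμν),
    toReal_rnDeriv_pos hμν, hμν.ae_le (toReal_rnDeriv_pos hνκ)] with x hx h1 h2
  simp only [llr_def]
  rw [← hx, Pi.mul_apply, ENNReal.toReal_mul, Real.log_mul h1.ne' h2.ne']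

lemma llr_prod {μ' ν' : Measure β} [SigmaFinite μ] [SigmaFinite ν] [SigmaFinite μ']
    [SigmaFinite ν'] (h : μ ≪ ν) (h' : μ' ≪ ν') :
    ∀ᵐ p ∂(μ.prod μ'), llr (μ.prod μ') (ν.prod ν') p = llr μ ν p.1 + llr μ' ν' p.2 := by
  have hd : (μ.prod μ').rnDeriv (ν.prod ν') =ᵐ[ν.prod ν']
      fun p ↦ μ.rnDeriv ν p.1 * μ'.rnDeriv ν' p.2 := by
    have hprod : μ.prod μ' =
        (ν.prod ν').withDensity (fun p ↦ μ.rnDeriv ν p.1 * μ'.rnDeriv ν' p.2) := by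
      rw [← prod_withDensity (Measure.measurable_rnDeriv _ _) (Measure.measurable_rnDeriv _ _),
        Measure.withDensity_rnDeriv_eq _ _ h, Measure.withDensity_rnDeriv_eq _ _ h']
    rw [hprod]
    exact Measure.rnDeriv_withDensity _ (by fun_prop)
  filter_upwards [(h.prod h').ae_le hd,
    Measure.quasiMeasurePreserving_fst.ae (toReal_rnDeriv_pos h),
    Measure.quasiMeasurePreserving_snd.ae (toReal_rnDeriv_pos h')] with p hp h1 h2
  simp only [llr_def]
  rw [hp, ENNReal.toReal_mul, Real.log_mul h1.ne' h2.ne']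

/-- A variational (Fenchel–Young) lower bound for the Kullback–Leibler divergence. -/
lemma integral_llr_le_of_lintegral_ne_top {P Q : Measure α} [SigmaFinite P] [SigmaFinite Q]
    [IsProbabilityMeasure μ] [IsFiniteMeasure ν] (hc : c ≠ 0) (hc' : c ≠ ∞)
    (hPQ : P ≪ Q) (hμP : μ ≪ P) (hf : Integrable (llr P Q) μ)
    (hμν : μ ≪ ν) (h_int : Integrable (llr μ ν) μ) (hfin : ∫⁻ x, P.rnDeriv Q x ∂ν ≠ ∞) :
    ∫ x, llr P Q x ∂μ ≤
      ∫ x, llr μ ν x ∂μ - Real.log c.toReal + c.toReal * (∫⁻ x, P.rnDeriv Q x ∂ν).toReal - 1 := by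
  set g : α → ℝ≥0∞ := fun x ↦ ν.rnDeriv μ x * P.rnDeriv Q x with hg
  have hgm : Measurable g := by fun_prop
  have hle : ∫⁻ x, g x ∂μ ≤ ∫⁻ x, P.rnDeriv Q x ∂ν := by
    rw [hg, ← Pi.mul_def, ← lintegral_withDensity_eq_lintegral_mul _
      (Measure.measurable_rnDeriv ν μ) (Measure.measurable_rnDeriv P Q)]
    exact lintegral_mono' (Measure.withDensity_rnDeriv_le ν μ) le_rfl
  have hg_ne : ∫⁻ x, g x ∂μ ≠ ∞ := ne_top_of_le_ne_top hfin hle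
  have hg_int : Integrable (fun x ↦ (g x).toReal) μ :=
    integrable_toReal_of_lintegral_ne_top hgm.aemeasurable hg_ne
  have hg_le : ∫ x, (g x).toReal ∂μ ≤ (∫⁻ x, P.rnDeriv Q x ∂ν).toReal := by
    rw [integral_toReal hgm.aemeasurable (ae_lt_top hgm hg_ne)]
    exact ENNReal.toReal_mono hfin hle
  have hc0 : 0 < c.toReal := ENNReal.toReal_pos hc hc'
  have hpt : ∀ᵐ x ∂μ,
      llr P Q x ≤ llr μ ν x + (c.toReal * (g x).toReal + (-Real.log c.toReal - 1)) := by
    filter_upwards [hμP.ae_le (toReal_rnDeriv_pos hPQ), Measure.rnDeriv_pos' hμν,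
      Measure.rnDeriv_ne_top ν μ, neg_llr hμν] with x h1 h2 h3 h4
    have h2' := ENNReal.toReal_pos h2.ne' h3
    have := Real.log_le_sub_one_of_pos (mul_pos hc0 (mul_pos h2' h1))
    rw [Real.log_mul hc0.ne' (by positivity), Real.log_mul h2'.ne' h1.ne'] at this
    simp only [Pi.neg_apply, llr_def] at h4
    simp only [llr_def, hg, ENNReal.toReal_mul]
    linarith
  have hr : Integrable (fun x ↦ c.toReal * (g x).toReal + (-Real.log c.toReal - 1)) μ :=
    (hg_int.const_mul _).add (integrable_const _)
  calc ∫ x, llr P Q x ∂μ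
    _ ≤ ∫ x, llr μ ν x + (c.toReal * (g x).toReal + (-Real.log c.toReal - 1)) ∂μ :=
      integral_mono_ae hf (h_int.add hr) hpt
    _ = ∫ x, llr μ ν x ∂μ + (c.toReal * ∫ x, (g x).toReal ∂μ + (-Real.log c.toReal - 1)) := by
      rw [integral_add h_int hr, integral_add (hg_int.const_mul _) (integrable_const _),
        integral_const_mul]
      simp
    _ ≤ _ := by nlinarith [mul_le_mul_of_nonneg_left hg_le hc0.le]

/-- If `c • μ ≤ P`, then the divergence of `μ` from the product of its marginals exceeds the mean
of `llr P Q` under `μ`, with `Q` the product of the marginals of `P`, by at most `-log c`. -/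
lemma integral_llr_prod_marginals_le {μ P : Measure (α × β)} [IsProbabilityMeasure μ]
    [IsProbabilityMeasure P] (hc : c ≠ 0) (hc' : c ≠ ∞) (h : c • μ ≤ P)
    (hP : P ≪ P.fst.prod P.snd) (hP_int : Integrable (llr P (P.fst.prod P.snd)) P)
    (hμ : μ ≪ μ.fst.prod μ.snd) (hμ_int : Integrable (llr μ (μ.fst.prod μ.snd)) μ) :
    ∫ x, llr μ (μ.fst.prod μ.snd) x ∂μ ≤
      ∫ x, llr P (P.fst.prod P.snd) x ∂μ - Real.log c.toReal := by
  have h1 : c • μ.fst ≤ P.fst := by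
    rw [Measure.fst, Measure.fst, ← Measure.map_smul]
    exact Measure.map_mono h measurable_fst
  have h2 : c • μ.snd ≤ P.snd := by
    rw [Measure.snd, Measure.snd, ← Measure.map_smul]
    exact Measure.map_mono h measurable_snd
  have ac1 := absolutelyContinuous_of_smul_le hc h1
  have ac2 := absolutelyContinuous_of_smul_le hc h2
  have i1 := integrable_llr_of_smul_le hc hc' h1
  have i2 := integrable_llr_of_smul_le hc hc' h2
  have j1 : Integrable (fun p : α × β ↦ llr μ.fst P.fst p.1) μ := i1.comp_measurable measurable_fst
  have j2 : Integrable (fun p : α × β ↦ llr μ.snd P.snd p.2) μ := i2.comp_measurable measurable_snd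
  have n1 : 0 ≤ ∫ p, llr μ.fst P.fst p.1 ∂μ := by
    rw [← integral_map (φ := Prod.fst) measurable_fst.aemeasurable
      (stronglyMeasurable_llr _ _).aestronglyMeasurable, ← Measure.fst]
    exact integral_llr_nonneg ac1 i1
  have n2 : 0 ≤ ∫ p, llr μ.snd P.snd p.2 ∂μ := by
    rw [← integral_map (φ := Prod.snd) measurable_snd.aemeasurable
      (stronglyMeasurable_llr _ _).aestronglyMeasurable, ← Measure.snd]
    exact integral_llr_nonneg ac2 i2
  have hf : Integrable (llr P (P.fst.prod P.snd)) μ := Integrable.of_smul_le hc hc' h hP_int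
  have hpt : ∀ᵐ p ∂μ, llr μ (μ.fst.prod μ.snd) p + (llr μ.fst P.fst p.1 + llr μ.snd P.snd p.2) ≤
      llr P (P.fst.prod P.snd) p + -Real.log c.toReal := by
    filter_upwards [llr_chain hμ (ac1.prod ac2), hμ.ae_le (llr_prod ac1 ac2),
      llr_chain (absolutelyContinuous_of_smul_le hc h) hP, llr_le_neg_log_of_smul_le hc hc' h]
      with p h1 h2 h3 h4
    linarith
  have h_mean := integral_mono_ae (hμ_int.add (j1.add j2)) (hf.add (integrable_const _)) hpt
  rw [integral_add' hμ_int (j1.add j2), integral_add' j1 j2, integral_add' hf (integrable_const _),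
    integral_const, probReal_univ, one_smul] at h_mean
  linarith

lemma klDiv_ne_top_iff : klDiv μ ν ≠ ∞ ↔ μ ≪ ν ∧ Integrable (llr μ ν) μ := by
  rw [klDiv]
  split_ifs with h <;> simp [h]

lemma toReal_klDiv_eq_integral_llr [IsProbabilityMeasure μ] [IsProbabilityMeasure ν]
    (h : klDiv μ ν ≠ ∞) : (klDiv μ ν).toReal = ∫ x, llr μ ν x ∂μ := by
  obtain ⟨hac, hint⟩ := klDiv_ne_top_iff.1 h
  rw [klDiv, if_pos ⟨hac, hint⟩, ENNReal.toReal_ofReal (integral_llr_nonneg hac hint)]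

end LogLikelihoodRatio

lemma ENNReal.hasSum_toReal_of_tsum_ne_top {ι : Type*} {f : ι → ℝ≥0∞} (h : ∑' i, f i ≠ ∞) :
    HasSum (fun i ↦ (f i).toReal) (∑' i, f i).toReal := by
  rw [ENNReal.tsum_toReal_eq (ENNReal.ne_top_of_tsum_ne_top h)]
  exact ENNReal.hasSum_toReal h

section Mixture

variable {ι α β : Type*} [Countable ι] {mα : MeasurableSpace α} {mβ : MeasurableSpace β}
  {c : ι → ℝ≥0∞} {ρ : ι → Measure (α × β)} {P : Measure (α × β)}

lemma tsum_sq_mul_lintegral_prod_marginals_le [IsFiniteMeasure P] [∀ i, IsFiniteMeasure (ρ i)]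
    (hsum : Measure.sum (fun i ↦ c i • ρ i) = P) (f : α × β → ℝ≥0∞) :
    ∑' i, c i ^ 2 * ∫⁻ x, f x ∂((ρ i).fst.prod (ρ i).snd) ≤ ∫⁻ x, f x ∂(P.fst.prod P.snd) := by
  have hsnd : Measure.sum (fun i ↦ c i • (ρ i).snd) = P.snd := by
    rw [← hsum, Measure.snd, Measure.map_sum measurable_snd.aemeasurable]
    simp [Measure.snd]
  have hfst (i : ι) : c i • (ρ i).fst ≤ P.fst := by
    rw [Measure.fst, Measure.fst, ← Measure.map_smul]
    exact Measure.map_mono (hsum ▸ Measure.le_sum _ i) measurable_fst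
  calc ∑' i, c i ^ 2 * ∫⁻ x, f x ∂((ρ i).fst.prod (ρ i).snd)
    _ = ∑' i, ∫⁻ x, f x ∂((c i • (ρ i).fst).prod (c i • (ρ i).snd)) := by
      congr with i
      rw [Measure.prod_smul_left, Measure.prod_smul_right, smul_smul, lintegral_smul_measure,
        smul_eq_mul, sq]
    _ ≤ ∑' i, ∫⁻ x, f x ∂(P.fst.prod (c i • (ρ i).snd)) :=
      ENNReal.tsum_le_tsum fun i ↦ lintegral_mono' (Measure.prod_mono (hfst i) le_rfl) le_rfl
    _ = ∫⁻ x, f x ∂(P.fst.prod P.snd) := by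
      rw [← lintegral_sum_measure, ← Measure.prod_sum_right, hsnd]

/-- For a countable mixture `P = ∑ i, c i • ρ i` of probability measures on a product space, the
divergence of `P` from the product of its marginals differs from the average of those of the `ρ i`
by at most the entropy of the weights. -/
theorem abs_klDiv_sub_tsum_klDiv_le [IsProbabilityMeasure P] [∀ i, IsFiniteMeasure (ρ i)]
    (hρ : ∀ i, c i ≠ 0 → IsProbabilityMeasure (ρ i)) (hc : ∀ i, c i ≠ ∞)
    (hsum : Measure.sum (fun i ↦ c i • ρ i) = P)
    (hP : klDiv P (P.fst.prod P.snd) ≠ ∞)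
    (hfin : ∑' i, c i * klDiv (ρ i) ((ρ i).fst.prod (ρ i).snd) ≠ ∞) :
    ENNReal.ofReal |(klDiv P (P.fst.prod P.snd)).toReal -
        (∑' i, c i * klDiv (ρ i) ((ρ i).fst.prod (ρ i).snd)).toReal| ≤
      ∑' i, ENNReal.ofReal (Real.negMulLog (c i).toReal) := by
  by_cases hH : ∑' i, ENNReal.ofReal (Real.negMulLog (c i).toReal) = ∞
  · simp [hH]
  obtain ⟨hPac, hPint⟩ := klDiv_ne_top_iff.1 hP
  set Q := P.fst.prod P.snd with hQ
  have hle (i : ι) : c i • ρ i ≤ P := hsum ▸ Measure.le_sum _ i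
  have hc_sum : ∑' i, c i = 1 := by
    rw [← measure_univ (μ := P), ← hsum, Measure.sum_apply _ .univ]
    congr with i
    by_cases hi : c i = 0
    · simp [hi]
    · have := hρ i hi
      simp
  have hc_le (i : ι) : (c i).toReal ≤ 1 := by
    have : c i ≤ 1 := hc_sum ▸ ENNReal.le_tsum i
    simpa using ENNReal.toReal_mono ENNReal.one_ne_top this
  have hη (i : ι) : 0 ≤ Real.negMulLog (c i).toReal :=
    Real.negMulLog_nonneg ENNReal.toReal_nonneg (hc_le i)
  -- the correction terms have total mass at most one
  set r : ι → ℝ≥0∞ := fun i ↦ c i ^ 2 * ∫⁻ x, P.rnDeriv Q x ∂((ρ i).fst.prod (ρ i).snd) with hr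
  have hr_le : ∑' i, r i ≤ 1 := by
    refine (tsum_sq_mul_lintegral_prod_marginals_le hsum _).trans ?_
    rw [← hQ, Measure.lintegral_rnDeriv hPac, measure_univ]
  have hr_ne : ∑' i, r i ≠ ∞ := ne_top_of_le_ne_top ENNReal.one_ne_top hr_le
  have sF : HasSum (fun i ↦ (c i).toReal * ∫ x, llr P Q x ∂(ρ i))
      (klDiv P Q).toReal := by
    rw [toReal_klDiv_eq_integral_llr hP]
    have := hasSum_integral_measure (f := llr P Q) (μ := fun i ↦ c i • ρ i) (by rwa [hsum])
    simpa only [hsum, integral_smul_measure, smul_eq_mul] using this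
  have sD := ENNReal.hasSum_toReal_of_tsum_ne_top hfin
  have sη := ENNReal.hasSum_toReal_of_tsum_ne_top hH
  have sr := ENNReal.hasSum_toReal_of_tsum_ne_top hr_ne
  have sc := ENNReal.hasSum_toReal_of_tsum_ne_top (f := c) (by simp [hc_sum])
  simp only [ENNReal.toReal_ofReal (hη _)] at sη
  simp only [ENNReal.toReal_mul] at sD
  rw [hc_sum, ENNReal.toReal_one] at sc
  have hr_toReal : (∑' i, r i).toReal ≤ 1 := by
    simpa using ENNReal.toReal_mono ENNReal.one_ne_top hr_le
  have h_ne (i : ι) (hi : c i ≠ 0) : klDiv (ρ i) ((ρ i).fst.prod (ρ i).snd) ≠ ∞ := fun h ↦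
    ENNReal.ne_top_of_tsum_ne_top hfin i (by rw [h, ENNReal.mul_top hi])
  have upper (i : ι) : (c i).toReal * ∫ x, llr P Q x ∂(ρ i) ≤
      (c i).toReal * (klDiv (ρ i) ((ρ i).fst.prod (ρ i).snd)).toReal +
        Real.negMulLog (c i).toReal + (r i).toReal - (c i).toReal := by
    by_cases hi : c i = 0
    · simp [hr, hi]
    have := hρ i hi
    obtain ⟨hac, hint⟩ := klDiv_ne_top_iff.1 (h_ne i hi)
    have hlin : ∫⁻ x, P.rnDeriv Q x ∂((ρ i).fst.prod (ρ i).snd) ≠ ∞ := fun h ↦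
      ENNReal.ne_top_of_tsum_ne_top hr_ne i
        (by simp only [hr, h]; exact ENNReal.mul_top (pow_ne_zero 2 hi))
    have key := integral_llr_le_of_lintegral_ne_top hi (hc i) hPac
      (absolutelyContinuous_of_smul_le hi (hle i))
      (Integrable.of_smul_le hi (hc i) (hle i) hPint) hac hint hlin
    rw [toReal_klDiv_eq_integral_llr (h_ne i hi)]
    simp only [hr, ENNReal.toReal_mul, ENNReal.toReal_pow, Real.negMulLog]
    nlinarith [mul_le_mul_of_nonneg_left key (ENNReal.toReal_nonneg (a := c i))]
  have lower (i : ι) : (c i).toReal * (klDiv (ρ i) ((ρ i).fst.prod (ρ i).snd)).toReal ≤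
      (c i).toReal * ∫ x, llr P Q x ∂(ρ i) + Real.negMulLog (c i).toReal := by
    by_cases hi : c i = 0
    · simp [hi]
    have := hρ i hi
    obtain ⟨hac, hint⟩ := klDiv_ne_top_iff.1 (h_ne i hi)
    have key := integral_llr_prod_marginals_le hi (hc i) (hle i) hPac hPint hac hint
    rw [toReal_klDiv_eq_integral_llr (h_ne i hi), Real.negMulLog]
    nlinarith [mul_le_mul_of_nonneg_left key (ENNReal.toReal_nonneg (a := c i))]
  refine ENNReal.ofReal_le_of_le_toReal (abs_sub_le_iff.2 ⟨?_, ?_⟩)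
  · linarith [hasSum_le upper sF (((sD.add sη).add sr).sub sc)]
  · linarith [hasSum_le lower sD (sF.add sη)]

end Mixture

lemma sum_measure_smul_cond_fiber {Ω 𝒵 : Type*} [MeasurableSpace Ω] [MeasurableSpace 𝒵]
    [MeasurableSingletonClass 𝒵] [Countable 𝒵] (μ : Measure Ω) [IsFiniteMeasure μ] {Z : Ω → 𝒵}
    (hZ : Measurable Z) : Measure.sum (fun z ↦ μ (Z ⁻¹' {z}) • μ[|Z ⁻¹' {z}]) = μ := by
  have hcond (z : 𝒵) : μ (Z ⁻¹' {z}) • μ[|Z ⁻¹' {z}] = μ.restrict (Z ⁻¹' {z}) := by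
    ext s hs
    rw [Measure.smul_apply, smul_eq_mul, mul_comm, cond_mul_eq_inter (hZ (.singleton z)),
      Measure.restrict_apply hs, Set.inter_comm]
  simp_rw [hcond]
  rw [← Measure.restrict_iUnion (fun z w hzw ↦ Disjoint.preimage Z (by simpa using hzw))
    (fun z ↦ hZ (.singleton z)), ← Set.preimage_iUnion, Set.iUnion_of_singleton, Set.preimage_univ,
    Measure.restrict_univ]

/-- Lemma 1: for random variables `X`, `Y` with values in standard Borel spaces and a random
variable `Z` with values in a countable set, `|I(X;Y) − I(X;Y|Z)| ≤ H(Z)`, all the mutual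
informations involved being assumed finite. -/
theorem abs_miRV_sub_condMIRV_le_entropy
    {Ω 𝒳 𝒴 𝒵 : Type*} [MeasurableSpace Ω]
    [MeasurableSpace 𝒳] [StandardBorelSpace 𝒳]
    [MeasurableSpace 𝒴] [StandardBorelSpace 𝒴]
    [MeasurableSpace 𝒵] [MeasurableSingletonClass 𝒵] [Countable 𝒵]
    (μ : Measure Ω) [IsProbabilityMeasure μ]
    (X : Ω → 𝒳) (Y : Ω → 𝒴) (Z : Ω → 𝒵)
    (hX : Measurable X) (hY : Measurable Y) (hZ : Measurable Z)
    (hfin : miRV μ X Y ≠ ⊤) (hfin' : condMIRV μ X Y Z ≠ ⊤) :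
    ENNReal.ofReal |(miRV μ X Y).toReal - (condMIRV μ X Y Z).toReal| ≤ entropyRV μ Z := by
  have hXY : Measurable (fun ω ↦ (X ω, Y ω)) := hX.prodMk hY
  have := Measure.isProbabilityMeasure_map (μ := μ) hXY.aemeasurable
  have hmi (ν : Measure Ω) : miRV ν X Y = klDiv (ν.map fun ω ↦ (X ω, Y ω))
      ((ν.map fun ω ↦ (X ω, Y ω)).fst.prod (ν.map fun ω ↦ (X ω, Y ω)).snd) := by
    rw [miRV, Measure.fst_map_prodMk hY, Measure.snd_map_prodMk hX]
  have hsum : Measure.sum (fun z ↦ μ (Z ⁻¹' {z}) • (μ[|Z ⁻¹' {z}]).map (fun ω ↦ (X ω, Y ω))) =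
      μ.map (fun ω ↦ (X ω, Y ω)) := by
    simp_rw [← Measure.map_smul]
    rw [← Measure.map_sum hXY.aemeasurable, sum_measure_smul_cond_fiber μ hZ]
  simp only [condMIRV, hmi] at hfin hfin' ⊢
  simp only [entropyRV, Measure.map_apply hZ (measurableSet_singleton _)]
  refine abs_klDiv_sub_tsum_klDiv_le (fun z hz ↦ ?_) (fun z ↦ measure_ne_top _ _) hsum hfin hfin'
  have := cond_isProbabilityMeasure hz
  exact Measure.isProbabilityMeasure_map hXY.aemeasurable
end
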